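/- arXiv:1001.3242 — 2 statements merged into one kernel-verified Lean document; each statement's English description precedes it below -/
import Mathlib

section
/- For every integer d ≥ 1 and every real z with 0 ≤ z ≤ 1, (1 − (1−z)^d (1 + z d)) / (d + 1) ≤ z/2. -/
theorem two_mul_one_sub_pow_le {z : ℝ} (hz : z ≤ 1 / 2) (n : ℕ) :
    2 * (1 - z) ^ n ≤ 1 + (1 - 2 * z) ^ n := by
  have h := (convexOn_pow (𝕜 := ℝ) n).2 (Set.mem_Ici.2 (zero_le_one' ℝ))
    (Set.mem_Ici.2 (by linarith : (0 : ℝ) ≤ 1 - 2 * z))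
    (by norm_num : (0 : ℝ) ≤ 1 / 2) (by norm_num : (0 : ℝ) ≤ 1 / 2) (by norm_num)
  simp only [smul_eq_mul, one_pow] at h
  rw [show 1 / 2 * 1 + 1 / 2 * (1 - 2 * z) = 1 - z by ring] at h
  linarith

theorem two_mul_succ_mul_one_sub_pow_add_le {z : ℝ} (hz0 : 0 ≤ z) (hz : z ≤ 1 / 2) (d : ℕ) :
    2 * (d + 1) * z * (1 - z) ^ d + (1 - 2 * z) ^ (d + 1) ≤ 1 := by
  induction d with
  | zero => norm_num
  | succ d ih =>
    have h₁ := mul_le_mul_of_nonneg_left ih (by linarith : 0 ≤ 1 - z)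
    have h₂ := mul_le_mul_of_nonneg_left (two_mul_one_sub_pow_le hz (d + 1)) hz0
    push_cast
    ring_nf at h₁ h₂ ⊢
    linarith

theorem succ_mul_one_sub_pow_le_half {z : ℝ} (hz0 : 0 ≤ z) (hz1 : z ≤ 1) {d : ℕ} (hd : 1 ≤ d) :
    (d + 1) * z * (1 - z) ^ d ≤ 1 / 2 := by
  rcases le_total z (1 / 2) with hz | hz
  · have h := two_mul_succ_mul_one_sub_pow_add_le hz0 hz d
    have : 0 ≤ (1 - 2 * z) ^ (d + 1) := pow_nonneg (by linarith) _
    linarith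
  · induction d, hd using Nat.le_induction with
    | base => norm_num; nlinarith [sq_nonneg (z - 1 / 2)]
    | succ d hd ih =>
      have hp : 0 ≤ z * (1 - z) ^ d := mul_nonneg hz0 (pow_nonneg (by linarith) _)
      have hc : ((d : ℝ) + 2) * (1 - z) ≤ d + 1 := by
        have : (0 : ℝ) ≤ d := d.cast_nonneg
        nlinarith
      have h := mul_le_mul_of_nonneg_right hc hp
      push_cast
      ring_nf at h ih ⊢
      linarith

/-- For every integer `d ≥ 1` and every real `z` with `0 ≤ z ≤ 1`,
`(1 - (1-z)^d (1 + z d)) / (d + 1) ≤ z / 2`. -/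
theorem tree_height_key_inequality (d : ℕ) (hd : 1 ≤ d) (z : ℝ)
    (hz0 : 0 ≤ z) (hz1 : z ≤ 1) :
    (1 - (1 - z) ^ d * (1 + z * d)) / (d + 1) ≤ z / 2 := by
  rw [div_le_iff₀ (by positivity)]
  induction d, hd using Nat.le_induction with
  | base => norm_num; nlinarith
  | succ d hd ih =>
    have h := mul_le_mul_of_nonneg_left (succ_mul_one_sub_pow_le_half hz0 hz1 hd) hz0
    push_cast
    ring_nf at h ih ⊢
    linarith
end

section
/- Let (Ω, 𝒜, P) be a probability space and let Z_1, Z_2, …, Z_s : Ω → {0,1} be random variables such that for every l ∈ {1, …, s} and every subset S ⊆ {1, …, l−1} with P(⋂_{j∈S} {Z_j = 1}) > 0, the conditional probability P(Z_l = 1 | ⋂_{j∈S} {Z_j = 1}) ≤ P(Z_l = 1). Let μ = Σ_{l=1}^{s} E[Z_l]. Then for every δ > 0, P(Σ_{l=1}^{s} Z_l ≥ (1+δ)μ) ≤ (e^{δ} / (1+δ)^{1+δ})^{μ}. -/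
open MeasureTheory ProbabilityTheory Finset

/-- If each event is negatively correlated with every intersection of earlier events, then the
probability of an intersection is at most the product of the probabilities. -/
lemma measure_iInter_le_prod_of_cond_le {Ω ι : Type*} [MeasurableSpace Ω] [LinearOrder ι]
    (P : Measure Ω) [IsProbabilityMeasure P] (A : ι → Set Ω) (hA : ∀ i, MeasurableSet (A i))
    (hneg : ∀ (l : ι) (S : Finset ι), (∀ j ∈ S, j < l) → 0 < P (⋂ j ∈ S, A j) →
      P[|⋂ j ∈ S, A j] (A l) ≤ P (A l)) (S : Finset ι) :
    P (⋂ j ∈ S, A j) ≤ ∏ j ∈ S, P (A j) := by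
  induction S using Finset.induction_on_max with
  | empty => simp
  | insert l S hlt ih =>
    have hS : MeasurableSet (⋂ j ∈ S, A j) := S.measurableSet_biInter fun j _ => hA j
    rw [Finset.set_biInter_insert, Finset.prod_insert fun h => lt_irrefl l (hlt l h),
      Set.inter_comm]
    rcases eq_or_ne (P (⋂ j ∈ S, A j)) 0 with h0 | h0
    · rw [measure_mono_null Set.inter_subset_left h0]
      exact zero_le
    · rw [← cond_mul_eq_inter hS]
      exact mul_le_mul' (hneg l S hlt (pos_iff_ne_zero.2 h0)) ih

/-- The expectation of `∏ (1 + δ Z_i)` is at most `∏ (1 + δ E[Z_i])` for indicator variables whose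
joint success probabilities are at most the products of the individual ones. -/
lemma integral_prod_one_add_mul_le {Ω ι : Type*} [MeasurableSpace Ω] [Fintype ι]
    (P : Measure Ω) [IsProbabilityMeasure P] (Z : ι → Ω → ℝ)
    (hmeas : ∀ i, Measurable (Z i)) (h01 : ∀ i ω, Z i ω = 0 ∨ Z i ω = 1)
    (hprod : ∀ S : Finset ι, P (⋂ j ∈ S, {ω | Z j ω = 1}) ≤ ∏ j ∈ S, P {ω | Z j ω = 1})
    {δ : ℝ} (hδ : 0 ≤ δ) :
    Integrable (fun ω => ∏ i, (1 + δ * Z i ω)) P ∧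
      ∫ ω, ∏ i, (1 + δ * Z i ω) ∂P ≤ ∏ i, (1 + δ * ∫ ω, Z i ω ∂P) := by
  have hset (j : ι) : MeasurableSet {ω | Z j ω = 1} := hmeas j (measurableSet_singleton 1)
  have hind (S : Finset ι) : (fun ω => ∏ j ∈ S, Z j ω) =
      (⋂ j ∈ S, {ω | Z j ω = 1}).indicator 1 := by
    ext ω
    by_cases h : ∀ j ∈ S, Z j ω = 1
    · rw [Set.indicator_of_mem (by simpa using h)]
      exact Finset.prod_eq_one h
    · rw [Set.indicator_of_notMem (by simpa using h)]
      push Not at h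
      obtain ⟨j, hj, hne⟩ := h
      exact Finset.prod_eq_zero hj ((h01 j ω).resolve_right hne)
  have hmeasS (S : Finset ι) : MeasurableSet (⋂ j ∈ S, {ω | Z j ω = 1}) :=
    S.measurableSet_biInter fun j _ => hset j
  have hint (S : Finset ι) : Integrable (fun ω => ∏ j ∈ S, Z j ω) P := by
    rw [hind]
    exact (integrable_const (1 : ℝ)).indicator (hmeasS S)
  have hval (S : Finset ι) :
      ∫ ω, ∏ j ∈ S, Z j ω ∂P = P.real (⋂ j ∈ S, {ω | Z j ω = 1}) := by
    rw [hind, integral_indicator_one (hmeasS S)]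
  have hsingle (j : ι) : ∫ ω, Z j ω ∂P = P.real {ω | Z j ω = 1} := by
    simpa using hval {j}
  have hle (S : Finset ι) : ∫ ω, ∏ j ∈ S, Z j ω ∂P ≤ ∏ j ∈ S, ∫ ω, Z j ω ∂P := by
    rw [hval]
    simp_rw [hsingle, measureReal_def]
    rw [← ENNReal.toReal_prod]
    exact ENNReal.toReal_mono (ENNReal.prod_ne_top fun j _ => measure_ne_top P _) (hprod S)
  simp_rw [Finset.prod_one_add, Finset.prod_mul_distrib]
  refine ⟨integrable_finsetSum _ fun S _ => (hint S).const_mul _, ?_⟩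
  rw [integral_finsetSum _ fun S _ => (hint S).const_mul _]
  refine Finset.sum_le_sum fun S _ => ?_
  rw [integral_const_mul]
  exact mul_le_mul_of_nonneg_left (hle S) (Finset.prod_nonneg fun _ _ => hδ)

/-- Chernoff-type bound for negatively correlated `{0,1}`-valued random variables
(Lemma 2 of the paper): if `Z_1, …, Z_s : Ω → {0,1}` satisfy, for every `l` and every
subset `S ⊆ {1,…,l-1}` with `P(⋂_{j∈S} {Z_j = 1}) > 0`, that
`P(Z_l = 1 | ⋂_{j∈S} {Z_j = 1}) ≤ P(Z_l = 1)`, and `μ = ∑_l E[Z_l]`, then for every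
`δ > 0`, `P(∑_l Z_l ≥ (1+δ)μ) ≤ (e^δ / (1+δ)^{1+δ})^μ`. -/
theorem chernoff_negatively_correlated {Ω : Type*} [MeasurableSpace Ω]
    (P : Measure Ω) [IsProbabilityMeasure P] (s : ℕ)
    (Z : Fin s → Ω → ℝ)
    (hZmeas : ∀ l, Measurable (Z l))
    (hZ01 : ∀ l ω, Z l ω = 0 ∨ Z l ω = 1)
    (hneg : ∀ (l : Fin s) (S : Finset (Fin s)), (∀ j ∈ S, j < l) →
      0 < P (⋂ j ∈ S, {ω | Z j ω = 1}) →
      P[|⋂ j ∈ S, {ω | Z j ω = 1}] {ω | Z l ω = 1} ≤ P {ω | Z l ω = 1})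
    (μ : ℝ) (hμ : μ = ∑ l : Fin s, ∫ ω, Z l ω ∂P)
    (δ : ℝ) (hδ : 0 < δ) :
    P {ω | (1 + δ) * μ ≤ ∑ l : Fin s, Z l ω}
      ≤ ENNReal.ofReal ((Real.exp δ / (1 + δ) ^ (1 + δ)) ^ μ) := by
  have hδ1 : 0 < 1 + δ := by linarith
  obtain ⟨hint, hE⟩ := integral_prod_one_add_mul_le P Z hZmeas hZ01
    (measure_iInter_le_prod_of_cond_le P (fun j => {ω | Z j ω = 1})
      (fun j => hZmeas j (measurableSet_singleton 1)) hneg) hδ.le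
  have hexp : ∏ l, (1 + δ * ∫ ω, Z l ω ∂P) ≤ Real.exp (δ * μ) := by
    rw [hμ, Finset.mul_sum, Real.exp_sum]
    refine Finset.prod_le_prod (fun l _ => ?_) fun l _ => ?_
    · have : 0 ≤ ∫ ω, Z l ω ∂P := integral_nonneg fun ω => by
        rcases hZ01 l ω with h | h <;> simp [h]
      positivity
    · linarith [Real.add_one_le_exp (δ * ∫ ω, Z l ω ∂P)]
  have hpow (ω : Ω) : ∏ l, (1 + δ * Z l ω) = (1 + δ) ^ (∑ l, Z l ω) := by
    rw [Real.rpow_sum_of_pos hδ1]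
    refine Finset.prod_congr rfl fun l _ => ?_
    rcases hZ01 l ω with h | h <;> simp [h]
  have hmarkov := mul_meas_ge_le_integral_of_nonneg
    (Filter.Eventually.of_forall fun ω => by
      rw [hpow]
      exact Real.rpow_nonneg hδ1.le _) hint ((1 + δ) ^ ((1 + δ) * μ))
  have hsets : {ω | (1 + δ) ^ ((1 + δ) * μ) ≤ ∏ l, (1 + δ * Z l ω)} =
      {ω | (1 + δ) * μ ≤ ∑ l, Z l ω} := by
    ext ω
    rw [Set.mem_ofPred_eq, hpow, Real.rpow_le_rpow_left_iff (by linarith), Set.mem_ofPred_eq]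
  rw [hsets] at hmarkov
  rw [← ofReal_measureReal]
  refine ENNReal.ofReal_le_ofReal ?_
  rw [Real.div_rpow (Real.exp_pos _).le (Real.rpow_nonneg hδ1.le _), ← Real.exp_mul,
    ← Real.rpow_mul hδ1.le, le_div_iff₀ (Real.rpow_pos_of_pos hδ1 _), mul_comm]
  exact hmarkov.trans (hE.trans hexp)
end
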